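/- Let S₃ = ⟨d₁,d₂,d₃⟩ be a non-symmetric numerical semigroup minimally generated by three positive integers. Then the rescaled genus h₁ = K₁/g₃² satisfies 5/36 < h₁ < 11/54. -/

import Mathlib

/-- A numerical semigroup: a subset of ℕ containing 0, closed under addition,
with finite complement (the set of gaps). -/
def IsNumericalSemigroup (S : Set ℕ) : Prop :=
  0 ∈ S ∧ (∀ a ∈ S, ∀ b ∈ S, a + b ∈ S) ∧ (Sᶜ : Set ℕ).Finite

/-- The genus: the number of gaps of `S`. -/
noncomputable def genus (S : Set ℕ) : ℕ := (Sᶜ : Set ℕ).ncard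

/-- The Frobenius number: the largest gap of `S`. -/
noncomputable def frobeniusNum (S : Set ℕ) : ℕ := sSup (Sᶜ : Set ℕ)

/-- The conductorNum: the least `c` such that every `n ≥ c` belongs to `S`
(equal to `frobeniusNum S + 1` when `S ≠ ℕ`). -/
noncomputable def conductorNum (S : Set ℕ) : ℕ := sInf {c : ℕ | ∀ n : ℕ, c ≤ n → n ∈ S}

/-- `S` is symmetric: for every `n` with `0 ≤ n ≤ F` (where `F = conductorNum S - 1` is the
Frobenius number), `n` is a gap iff `F - n ∈ S`. -/
def IsSymmetric (S : Set ℕ) : Prop :=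
  ∀ n : ℕ, n < conductorNum S → (n ∉ S ↔ conductorNum S - 1 - n ∈ S)

/-- The submonoid of ℕ generated by two elements. -/
def gen2 (x y : ℕ) : Set ℕ := {n : ℕ | ∃ a b : ℕ, n = a * x + b * y}

/-- The numerical semigroup `⟨d₁, d₂, d₃⟩` generated by three elements. -/
def gen3 (d₁ d₂ d₃ : ℕ) : Set ℕ := {n : ℕ | ∃ a b c : ℕ, n = a * d₁ + b * d₂ + c * d₃}

/-- `⟨d₁, d₂, d₃⟩` is minimally generated by the three positive integers `d₁ < d₂ < d₃`:
`gcd(d₁,d₂,d₃) = 1`, `3 ≤ d₁`, `d₃ ≤ d₁d₂ - d₁ - d₂`, and no generator lies in the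
submonoid generated by the other two. -/
def MinGen3 (d₁ d₂ d₃ : ℕ) : Prop :=
  3 ≤ d₁ ∧ d₁ < d₂ ∧ d₂ < d₃ ∧ d₃ + d₁ + d₂ ≤ d₁ * d₂ ∧
    Nat.gcd d₁ (Nat.gcd d₂ d₃) = 1 ∧
    d₁ ∉ gen2 d₂ d₃ ∧ d₂ ∉ gen2 d₁ d₃ ∧ d₃ ∉ gen2 d₁ d₂

/-- The `r`-th gap power sum (higher genus) `G_r = Σ_{s gap} s^r`. -/
noncomputable def gapPowerSum (S : Set ℕ) (r : ℕ) : ℕ := ∑ᶠ s ∈ (Sᶜ : Set ℕ), s ^ r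

/-- The integers representable as nonnegative combinations of `x`, `y`, `z`. -/
def IntGen (x y z : ℕ) (n : ℤ) : Prop := ∃ a b c : ℕ, n = a * x + b * y + c * z

/-- Symmetry of `⟨x, y, z⟩`, expressed by a reflection of `ℤ`. -/
def ReflSymm (x y z : ℕ) : Prop := ∃ F : ℤ, ∀ n : ℤ, IntGen x y z n ↔ ¬ IntGen x y z (F - n)

/-- `c` is the least positive multiplier with `c * x ∈ ⟨y, z⟩`. -/
def IsMinMult (x y z c : ℕ) : Prop :=
  0 < c ∧ ∀ i u v : ℕ, 0 < i → i * x = u * y + v * z → c ≤ i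

lemma IntGen.nonneg {x y z : ℕ} {n : ℤ} (h : IntGen x y z n) : 0 ≤ n := by
  obtain ⟨a, b, c, rfl⟩ := h
  positivity

lemma intGen_natCast {x y z n : ℕ} : IntGen x y z n ↔ n ∈ gen3 x y z := by
  constructor
  · rintro ⟨a, b, c, h⟩
    exact ⟨a, b, c, by exact_mod_cast h⟩
  · rintro ⟨a, b, c, h⟩
    exact ⟨a, b, c, by exact_mod_cast h⟩

lemma intGen_swap_left (x y z : ℕ) : IntGen x y z = IntGen y x z := by
  funext n
  apply propext
  constructor <;> rintro ⟨a, b, c, h⟩ <;> exact ⟨b, a, c, by rw [h]; ring⟩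

lemma intGen_swap_right (x y z : ℕ) : IntGen x y z = IntGen x z y := by
  funext n
  apply propext
  constructor <;> rintro ⟨a, b, c, h⟩ <;> exact ⟨a, c, b, by rw [h]; ring⟩

lemma reflSymm_swap_left (x y z : ℕ) : ReflSymm x y z ↔ ReflSymm y x z := by
  simp only [ReflSymm, intGen_swap_left x y z]

lemma reflSymm_swap_right (x y z : ℕ) : ReflSymm x y z ↔ ReflSymm x z y := by
  simp only [ReflSymm, intGen_swap_right x y z]

lemma IsMinMult.swap {x y z c : ℕ} (h : IsMinMult x y z c) : IsMinMult x z y c :=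
  ⟨h.1, fun i u v hi e => h.2 i v u hi (by rw [e]; ring)⟩

lemma ReflSymm.isSymmetric {x y z : ℕ} (h : ReflSymm x y z) : IsSymmetric (gen3 x y z) := by
  obtain ⟨F, hF⟩ := h
  have h0 : IntGen x y z 0 := ⟨0, 0, 0, by simp⟩
  have hFn : ¬ IntGen x y z F := by simpa using (hF 0).1 h0
  have hlarge : ∀ n : ℤ, F < n → IntGen x y z n := fun n hn =>
    (hF n).2 fun hc => by have := hc.nonneg; omega
  have hF1 : -1 ≤ F := by
    by_contra hlt
    have := (hlarge (-1) (by omega)).nonneg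
    omega
  have hc : (conductorNum (gen3 x y z) : ℤ) = F + 1 := by
    have hmem : (F + 1).toNat ∈ {c : ℕ | ∀ n : ℕ, c ≤ n → n ∈ gen3 x y z} := fun n hn =>
      intGen_natCast.1 (hlarge n (by omega))
    have hle : conductorNum (gen3 x y z) ≤ (F + 1).toNat := Nat.sInf_le hmem
    have hge : (F + 1).toNat ≤ conductorNum (gen3 x y z) := by
      by_contra hlt
      have hs : conductorNum (gen3 x y z) ∈ {c : ℕ | ∀ n : ℕ, c ≤ n → n ∈ gen3 x y z} :=
        Nat.sInf_mem ⟨_, hmem⟩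
      have := intGen_natCast.2 (hs F.toNat (by omega))
      rw [Int.toNat_of_nonneg (by omega)] at this
      exact hFn this
    omega
  intro n hn
  rw [← intGen_natCast, ← intGen_natCast, hF n, not_not]
  have : ((conductorNum (gen3 x y z) - 1 - n : ℕ) : ℤ) = F - n := by omega
  rw [this]

/-- Sylvester's reflection for two coprime generators. -/
lemma exists_rep_or_reflected {p q : ℕ} (hq : 0 < q) (hpq : IsCoprime (p : ℤ) q)
    (n : ℤ) : (∃ u v : ℕ, n = u * p + v * q) ∨
      ∃ u v : ℕ, (p * q - p - q - n : ℤ) = u * p + v * q := by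
  obtain ⟨s, t, hst⟩ := hpq
  have hq' : (0 : ℤ) < q := by exact_mod_cast hq
  have hu0 := Int.emod_nonneg (n * s) hq'.ne'
  have hu1 := Int.emod_lt_of_pos (n * s) hq'
  have hdm := Int.mul_ediv_add_emod (n * s) q
  set u := n * s % q
  set v := n * t + (n * s / q) * p with hv
  have hn : n = u * p + v * q := by
    rw [hv]
    linear_combination (-n) * hst + (p : ℤ) * (-hdm)
  rcases le_or_gt 0 v with h0 | h0
  · left
    refine ⟨u.toNat, v.toNat, ?_⟩
    rw [Int.toNat_of_nonneg hu0, Int.toNat_of_nonneg h0, ← hn]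
  · right
    refine ⟨(q - 1 - u).toNat, (-1 - v).toNat, ?_⟩
    rw [Int.toNat_of_nonneg (by omega), Int.toNat_of_nonneg (by omega)]
    linear_combination (-1) * hn

lemma not_rep_frobenius {p q : ℕ} (hq : 0 < q) (hpq : IsCoprime (p : ℤ) q)
    (u v : ℕ) : (p * q - p - q : ℤ) ≠ u * p + v * q := by
  intro h
  have hd : (q : ℤ) ∣ (u + 1) * p := ⟨p - v - 1, by linear_combination -h⟩
  have hle := Int.le_of_dvd (by positivity) (hpq.symm.dvd_of_dvd_mul_right hd)
  nlinarith [mul_le_mul_of_nonneg_right hle (Int.natCast_nonneg p),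
    mul_nonneg (Int.natCast_nonneg v) (Int.natCast_nonneg q)]

/-- A gluing of a two-generator semigroup is symmetric. -/
lemma reflSymm_of_gluing {g p q k : ℕ} (hg : 0 < g) (hq : 0 < q)
    (hpq : IsCoprime (p : ℤ) q) (hgk : IsCoprime (g : ℤ) k) {u v : ℕ} (hk : k = u * p + v * q) :
    ReflSymm (g * p) (g * q) k := by
  have hg' : (0 : ℤ) < g := by exact_mod_cast hg
  have hkz : (k : ℤ) = u * p + v * q := by exact_mod_cast hk
  refine ⟨g * (p * q - p - q) + (g - 1) * k, fun n => ⟨?_, fun hnot => ?_⟩⟩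
  · rintro ⟨a, b, c, h⟩ ⟨a', b', c', h'⟩
    have hsum : (g : ℤ) * (p * q - p - q) + (g - 1) * k =
        (a + a') * (g * p) + (b + b') * (g * q) + (c + c') * k := by
      push_cast at h h'
      linear_combination h + h'
    have hd : (g : ℤ) ∣ (c + c' + 1) * k :=
      ⟨p * q - p - q + k - (a + a') * p - (b + b') * q, by linear_combination -hsum⟩
    obtain ⟨m, hm⟩ := hgk.dvd_of_dvd_mul_right hd
    have hm1 : 1 ≤ m := by
      by_contra hlt
      have : (g : ℤ) * m ≤ 0 := mul_nonpos_of_nonneg_of_nonpos hg'.le (by omega)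
      omega
    lift m to ℕ using by omega
    obtain ⟨e, rfl⟩ : ∃ e, m = e + 1 := ⟨m - 1, by omega⟩
    refine not_rep_frobenius hq hpq (a + a' + e * u) (b + b' + e * v) ?_
    apply mul_left_cancel₀ hg'.ne'
    push_cast at hm ⊢
    linear_combination hsum + (k : ℤ) * hm + (g : ℤ) * e * hkz
  · obtain ⟨s, t, hst⟩ := hgk
    have hr0 := Int.emod_nonneg (n * t) hg'.ne'
    have hr1 := Int.emod_lt_of_pos (n * t) hg'
    have hdm := Int.mul_ediv_add_emod (n * t) g
    set r := n * t % g
    obtain ⟨z, hz⟩ : ∃ z : ℤ, n = r * k + g * z :=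
      ⟨n * s + n * t / g * k, by linear_combination (-n) * hst - (k : ℤ) * hdm⟩
    rcases exists_rep_or_reflected hq hpq z with ⟨i, j, hij⟩ | ⟨i, j, hij⟩
    · refine ⟨i, j, r.toNat, ?_⟩
      rw [Int.toNat_of_nonneg hr0, hz, hij]
      push_cast
      ring
    · refine absurd ⟨i, j, (g - 1 - r).toNat, ?_⟩ hnot
      rw [Int.toNat_of_nonneg (by omega)]
      push_cast
      linear_combination (-1) * hz + (g : ℤ) * hij

lemma pos_of_isMinMult {x y z c : ℕ} (hx : 0 < x) (hy : 0 < y)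
    (hxyz : Nat.gcd (Nat.gcd x y) z = 1) (hns : ¬ ReflSymm x y z) (hc : IsMinMult x y z c)
    {u v : ℕ} (h : c * x = u * y + v * z) : 0 < v := by
  by_contra hv
  obtain rfl : v = 0 := by omega
  apply hns
  obtain ⟨p, q, hcop, hxp, hyq⟩ := Nat.exists_coprime x y
  have hg : 0 < x.gcd y := Nat.gcd_pos_of_pos_left _ hx
  set g := x.gcd y
  have hp : 0 < p := Nat.pos_of_ne_zero (by rintro rfl; omega)
  have hq : 0 < q := Nat.pos_of_ne_zero (by rintro rfl; omega)
  have hpq : IsCoprime (p : ℤ) q := Nat.isCoprime_iff_coprime.2 hcop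
  have hcq : q ≤ c := by
    apply Nat.le_of_dvd hc.1
    apply hcop.symm.dvd_of_dvd_mul_right
    refine ⟨u, Nat.eq_of_mul_eq_mul_right hg ?_⟩
    rw [hxp, hyq] at h
    linear_combination h
  have hz : ∃ i j : ℕ, (z : ℤ) = i * p + j * q := by
    rcases exists_rep_or_reflected hq hpq z with hz | ⟨i, j, hij⟩
    · exact hz
    · exfalso
      have hlt : i + 1 < q := by
        by_contra hge
        have hge' : (q : ℤ) ≤ i + 1 := by omega
        nlinarith [mul_le_mul_of_nonneg_right hge' (Int.natCast_nonneg p),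
          mul_nonneg (Int.natCast_nonneg j) (Int.natCast_nonneg q)]
      obtain ⟨e, rfl⟩ : ∃ e, q = i + 1 + e := ⟨q - (i + 1), by omega⟩
      have := hc.2 e (j + 1) g (by omega) (by
        rw [hxp, hyq]
        zify
        push_cast at hij
        linear_combination (g : ℤ) * hij)
      omega
  obtain ⟨i, j, hij⟩ := hz
  have key := reflSymm_of_gluing hg hq hpq (Nat.isCoprime_iff_coprime.2 hxyz)
    (show z = i * p + j * q by exact_mod_cast hij)
  rwa [mul_comm g p, mul_comm g q, ← hxp, ← hyq] at key

/-- Herzog's relations among the generators of a non-symmetric semigroup. -/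
structure Herzog (d₁ d₂ d₃ a a' b b' c c' : ℕ) : Prop where
  a_pos : 0 < a
  a'_pos : 0 < a'
  b_pos : 0 < b
  b'_pos : 0 < b'
  c_pos : 0 < c
  c'_pos : 0 < c'
  rel₁ : (a + a') * d₁ = b' * d₂ + c * d₃
  rel₂ : (b + b') * d₂ = a * d₁ + c' * d₃
  rel₃ : (c + c') * d₃ = a' * d₁ + b * d₂
  min₁ : IsMinMult d₁ d₂ d₃ (a + a')
  min₂ : IsMinMult d₂ d₁ d₃ (b + b')
  min₃ : IsMinMult d₃ d₁ d₂ (c + c')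

lemma Herzog.swap {d₁ d₂ d₃ a a' b b' c c' : ℕ} (h : Herzog d₁ d₂ d₃ a a' b b' c c') :
    Herzog d₁ d₃ d₂ a' a c' c b' b where
  a_pos := h.a'_pos
  a'_pos := h.a_pos
  b_pos := h.c'_pos
  b'_pos := h.c_pos
  c_pos := h.b'_pos
  c'_pos := h.b_pos
  rel₁ := by linarith [h.rel₁]
  rel₂ := by linarith [h.rel₃]
  rel₃ := by linarith [h.rel₂]
  min₁ := add_comm a a' ▸ h.min₁.swap
  min₂ := add_comm c c' ▸ h.min₃
  min₃ := add_comm b b' ▸ h.min₂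

lemma exists_isMinMult {x y z : ℕ} (hy : 0 < y) :
    ∃ c u v : ℕ, IsMinMult x y z c ∧ c * x = u * y + v * z := by
  classical
  have hex : ∃ c : ℕ, 0 < c ∧ ∃ u v : ℕ, c * x = u * y + v * z :=
    ⟨y, hy, x, 0, by ring⟩
  obtain ⟨hpos, u, v, huv⟩ := Nat.find_spec hex
  exact ⟨Nat.find hex, u, v, ⟨hpos, fun i u' v' hi e => Nat.find_min' hex ⟨hi, u', v', e⟩⟩, huv⟩

/-- Coefficients in a minimal relation are smaller than the other minimal multipliers. -/
lemma coeff_lt_of_isMinMult {x y z cx cy : ℕ} (hz : 0 < z)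
    (hx : IsMinMult x y z cx) {u v : ℕ} (hu : 0 < u) (hv : 0 < v) (h : cx * x = u * y + v * z)
    {s t : ℕ} (hs : 0 < s) (h' : cy * y = s * x + t * z) : u < cy := by
  by_contra hge
  obtain ⟨e, rfl⟩ : ∃ e, u = cy + e := ⟨u - cy, by omega⟩
  have hsum : cx * x = s * x + (e * y + (t + v) * z) := by linear_combination h + h'
  have hpos : 0 < (t + v) * z := by positivity
  have hlt : s < cx := by
    by_contra hge
    have := Nat.mul_le_mul_right x (not_lt.1 hge)
    omega
  obtain ⟨f, rfl⟩ : ∃ f, cx = s + f := ⟨cx - s, by omega⟩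
  have := hx.2 f e (t + v) (by omega) (by linarith)
  omega

lemma IsMinMult.not_rep {x y z c : ℕ} (h : IsMinMult x y z c) {i u v : ℤ} (hi : 0 < i) (hic : i < c)
    (hu : 0 ≤ u) (hv : 0 ≤ v) : i * x ≠ u * y + v * z := by
  intro e
  lift i to ℕ using hi.le
  lift u to ℕ using hu
  lift v to ℕ using hv
  have := h.2 i u v (by omega) (by exact_mod_cast e)
  omega

lemma exists_herzog {d₁ d₂ d₃ : ℕ} (h₁ : 0 < d₁) (h₂ : 0 < d₂) (h₃ : 0 < d₃)
    (hgcd : Nat.gcd d₁ (Nat.gcd d₂ d₃) = 1) (hns : ¬ ReflSymm d₁ d₂ d₃) :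
    ∃ a a' b b' c c' : ℕ, Herzog d₁ d₂ d₃ a a' b b' c c' := by
  have hns132 : ¬ ReflSymm d₁ d₃ d₂ := by rwa [← reflSymm_swap_right]
  have hns213 : ¬ ReflSymm d₂ d₁ d₃ := by rwa [← reflSymm_swap_left]
  have hns231 : ¬ ReflSymm d₂ d₃ d₁ := by rwa [← reflSymm_swap_right]
  have hns312 : ¬ ReflSymm d₃ d₁ d₂ := by rwa [← reflSymm_swap_left]
  have hns321 : ¬ ReflSymm d₃ d₂ d₁ := by rwa [← reflSymm_swap_right]
  have g123 : Nat.gcd (Nat.gcd d₁ d₂) d₃ = 1 := by rw [Nat.gcd_assoc]; exact hgcd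
  have g132 : Nat.gcd (Nat.gcd d₁ d₃) d₂ = 1 := by rw [Nat.gcd_assoc, Nat.gcd_comm d₃]; exact hgcd
  have g231 : Nat.gcd (Nat.gcd d₂ d₃) d₁ = 1 := by rw [Nat.gcd_comm]; exact hgcd
  obtain ⟨c₁, r₁₂, r₁₃, m₁, e₁⟩ := exists_isMinMult (x := d₁) (z := d₃) h₂
  obtain ⟨c₂, r₂₁, r₂₃, m₂, e₂⟩ := exists_isMinMult (x := d₂) (z := d₃) h₁
  obtain ⟨c₃, r₃₁, r₃₂, m₃, e₃⟩ := exists_isMinMult (x := d₃) (z := d₂) h₁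
  have p₁₃ : 0 < r₁₃ := pos_of_isMinMult h₁ h₂ g123 hns m₁ e₁
  have p₁₂ : 0 < r₁₂ := pos_of_isMinMult h₁ h₃ g132 hns132 m₁.swap (e₁.trans (add_comm _ _))
  have p₂₃ : 0 < r₂₃ := pos_of_isMinMult h₂ h₁ (by rwa [Nat.gcd_comm d₂]) hns213 m₂ e₂
  have p₂₁ : 0 < r₂₁ := pos_of_isMinMult h₂ h₃ g231 hns231 m₂.swap (e₂.trans (add_comm _ _))
  have p₃₂ : 0 < r₃₂ := pos_of_isMinMult h₃ h₁ (by rwa [Nat.gcd_comm d₃]) hns312 m₃ e₃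
  have p₃₁ : 0 < r₃₁ :=
    pos_of_isMinMult h₃ h₂ (by rwa [Nat.gcd_comm d₃]) hns321 m₃.swap (e₃.trans (add_comm _ _))
  have l₁₂ : r₁₂ < c₂ := coeff_lt_of_isMinMult h₃ m₁ p₁₂ p₁₃ e₁ p₂₁ e₂
  have l₁₃ : r₁₃ < c₃ :=
    coeff_lt_of_isMinMult h₂ m₁.swap p₁₃ p₁₂ (e₁.trans (add_comm _ _)) p₃₁ e₃
  have l₂₁ : r₂₁ < c₁ := coeff_lt_of_isMinMult h₃ m₂ p₂₁ p₂₃ e₂ p₁₂ e₁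
  have l₂₃ : r₂₃ < c₃ := coeff_lt_of_isMinMult h₁ m₂.swap p₂₃ p₂₁ (e₂.trans (add_comm _ _)) p₃₂
    (e₃.trans (add_comm _ _))
  have l₃₁ : r₃₁ < c₁ := coeff_lt_of_isMinMult h₂ m₃ p₃₁ p₃₂ e₃ p₁₃ (e₁.trans (add_comm _ _))
  have l₃₂ : r₃₂ < c₂ := coeff_lt_of_isMinMult h₁ m₃.swap p₃₂ p₃₁ (e₃.trans (add_comm _ _)) p₂₃
    (e₂.trans (add_comm _ _))
  obtain ⟨X, hX⟩ : ∃ X : ℤ, X = c₁ - r₂₁ - r₃₁ := ⟨_, rfl⟩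
  obtain ⟨Y, hY⟩ : ∃ Y : ℤ, Y = c₂ - r₁₂ - r₃₂ := ⟨_, rfl⟩
  obtain ⟨Z, hZ⟩ : ∃ Z : ℤ, Z = c₃ - r₁₃ - r₂₃ := ⟨_, rfl⟩
  have hsum : X * d₁ + Y * d₂ + Z * d₃ = 0 := by
    zify at e₁ e₂ e₃
    rw [hX, hY, hZ]
    linear_combination e₁ + e₂ + e₃
  have nX : ∀ i u v : ℤ, 0 < i → i < c₁ → 0 ≤ u → 0 ≤ v → i * d₁ ≠ u * d₂ + v * d₃ :=
    fun i u v hi hic hu hv => m₁.not_rep hi hic hu hv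
  have nY : ∀ i u v : ℤ, 0 < i → i < c₂ → 0 ≤ u → 0 ≤ v → i * d₂ ≠ u * d₁ + v * d₃ :=
    fun i u v hi hic hu hv => m₂.not_rep hi hic hu hv
  have nZ : ∀ i u v : ℤ, 0 < i → i < c₃ → 0 ≤ u → 0 ≤ v → i * d₃ ≠ u * d₁ + v * d₂ :=
    fun i u v hi hic hu hv => m₃.not_rep hi hic hu hv
  have k₁ : ¬ (0 < X ∧ Y ≤ 0 ∧ Z ≤ 0) := fun ⟨a, b, c⟩ =>
    nX X (-Y) (-Z) a (by omega) (by omega) (by omega) (by linear_combination hsum)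
  have k₂ : ¬ (0 < Y ∧ X ≤ 0 ∧ Z ≤ 0) := fun ⟨a, b, c⟩ =>
    nY Y (-X) (-Z) a (by omega) (by omega) (by omega) (by linear_combination hsum)
  have k₃ : ¬ (0 < Z ∧ X ≤ 0 ∧ Y ≤ 0) := fun ⟨a, b, c⟩ =>
    nZ Z (-X) (-Y) a (by omega) (by omega) (by omega) (by linear_combination hsum)
  have k₄ : ¬ (X < 0 ∧ 0 ≤ Y ∧ 0 ≤ Z) := fun ⟨a, b, c⟩ =>
    nX (-X) Y Z (by omega) (by omega) b c (by linear_combination -hsum)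
  have k₅ : ¬ (Y < 0 ∧ 0 ≤ X ∧ 0 ≤ Z) := fun ⟨a, b, c⟩ =>
    nY (-Y) X Z (by omega) (by omega) b c (by linear_combination -hsum)
  have k₆ : ¬ (Z < 0 ∧ 0 ≤ X ∧ 0 ≤ Y) := fun ⟨a, b, c⟩ =>
    nZ (-Z) X Y (by omega) (by omega) b c (by linear_combination -hsum)
  have hd₁ : (0 : ℤ) < d₁ := by exact_mod_cast h₁
  have hd₂ : (0 : ℤ) < d₂ := by exact_mod_cast h₂
  have hd₃ : (0 : ℤ) < d₃ := by exact_mod_cast h₃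
  have knonpos : ¬ (X ≤ 0 ∧ Y ≤ 0 ∧ Z ≤ 0 ∧ X + Y + Z < 0) := fun ⟨a, b, c, d⟩ => by
    have := mul_nonneg_of_nonpos_of_nonpos a (by omega : 1 - (d₁ : ℤ) ≤ 0)
    have := mul_nonneg_of_nonpos_of_nonpos b (by omega : 1 - (d₂ : ℤ) ≤ 0)
    have := mul_nonneg_of_nonpos_of_nonpos c (by omega : 1 - (d₃ : ℤ) ≤ 0)
    linarith
  have knonneg : ¬ (0 ≤ X ∧ 0 ≤ Y ∧ 0 ≤ Z ∧ 0 < X + Y + Z) := fun ⟨a, b, c, d⟩ => by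
    have := mul_nonneg a (by omega : 0 ≤ (d₁ : ℤ) - 1)
    have := mul_nonneg b (by omega : 0 ≤ (d₂ : ℤ) - 1)
    have := mul_nonneg c (by omega : 0 ≤ (d₃ : ℤ) - 1)
    linarith
  obtain ⟨hX0, hY0, hZ0⟩ : X = 0 ∧ Y = 0 ∧ Z = 0 := by
    clear hX hY hZ hsum e₁ e₂ e₃
    omega
  obtain rfl : c₁ = r₂₁ + r₃₁ := by omega
  obtain rfl : c₂ = r₃₂ + r₁₂ := by omega
  obtain rfl : c₃ = r₁₃ + r₂₃ := by omega
  exact ⟨r₂₁, r₃₁, r₃₂, r₁₂, r₁₃, r₂₃, p₂₁, p₃₁, p₃₂, p₁₂, p₁₃, p₂₃, e₁, e₂, e₃, m₁, m₂, m₃⟩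

/-- The L-shaped set of exponents `(j, k)` whose values `j * d₂ + k * d₃` form the Apéry set
of `⟨d₁, d₂, d₃⟩` with respect to `d₁`. -/
def lShape (b b' c c' : ℕ) : Finset (ℕ × ℕ) :=
  Finset.range (b + b') ×ˢ Finset.range c ∪ Finset.range b' ×ˢ Finset.Ico c (c + c')

lemma mem_lShape {b b' c c' : ℕ} {p : ℕ × ℕ} :
    p ∈ lShape b b' c c' ↔ p.1 < b + b' ∧ p.2 < c + c' ∧ (p.1 < b' ∨ p.2 < c) := by
  simp only [lShape, Finset.mem_union, Finset.mem_product, Finset.mem_range, Finset.mem_Ico]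
  omega

lemma sum_lShape {M : Type*} [AddCommGroup M] (b b' c c' : ℕ) (f : ℕ → ℕ → M) :
    ∑ p ∈ lShape b b' c c', f p.1 p.2 =
      ∑ j ∈ Finset.range (b + b'), ∑ k ∈ Finset.range c, f j k +
      (∑ j ∈ Finset.range b', ∑ k ∈ Finset.range (c + c'), f j k -
        ∑ j ∈ Finset.range b', ∑ k ∈ Finset.range c, f j k) := by
  rw [lShape, Finset.sum_union, Finset.sum_product, Finset.sum_product, ← Finset.sum_sub_distrib]
  · congr 1
    exact Finset.sum_congr rfl fun j _ => Finset.sum_Ico_eq_sub _ (by omega)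
  · rw [Finset.disjoint_left]
    simp only [Finset.mem_product, Finset.mem_range, Finset.mem_Ico]
    omega

namespace Herzog

variable {d₁ d₂ d₃ a a' b b' c c' : ℕ}

lemma exists_lShape_rep (h : Herzog d₁ d₂ d₃ a a' b b' c c') (h₁ : 0 < d₁) {n : ℕ}
    (hn : n ∈ gen3 d₁ d₂ d₃) :
    ∃ i : ℕ, ∃ p ∈ lShape b b' c c', n = i * d₁ + p.1 * d₂ + p.2 * d₃ := by
  classical
  have hbd : ∃ m : ℕ, ∃ i j k : ℕ, n = i * d₁ + j * d₂ + k * d₃ ∧ i + m = n := by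
    obtain ⟨i, j, k, e⟩ := hn
    have : i ≤ i * d₁ := Nat.le_mul_of_pos_right i h₁
    exact ⟨n - i, i, j, k, e, by omega⟩
  obtain ⟨i, j, k, e, him⟩ := Nat.find_spec hbd
  have hmax : ∀ i' j' k' : ℕ, n = i' * d₁ + j' * d₂ + k' * d₃ → i' ≤ i := fun i' j' k' e' => by
    have : i' ≤ i' * d₁ := Nat.le_mul_of_pos_right i' h₁
    have := Nat.find_min' hbd ⟨i', j', k', e', (by omega : i' + (n - i') = n)⟩
    omega
  have ha := h.a_pos
  have ha' := h.a'_pos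
  refine ⟨i, (j, k), mem_lShape.2 ⟨?_, ?_, ?_⟩, e⟩
  · by_contra hge
    obtain ⟨s, rfl⟩ : ∃ s, j = b + b' + s := ⟨j - (b + b'), by omega⟩
    have := hmax (i + a) s (k + c') (by linear_combination e + h.rel₂)
    omega
  · by_contra hge
    obtain ⟨s, rfl⟩ : ∃ s, k = c + c' + s := ⟨k - (c + c'), by omega⟩
    have := hmax (i + a') (j + b) s (by linear_combination e + h.rel₃)
    omega
  · by_contra! hge
    obtain ⟨s, rfl⟩ : ∃ s, j = b' + s := ⟨j - b', by omega⟩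
    obtain ⟨t, rfl⟩ : ∃ t, k = c + t := ⟨k - c, by omega⟩
    have := hmax (i + (a + a')) s t (by linear_combination e - h.rel₁)
    omega

lemma not_lt_of_rep_eq (h : Herzog d₁ d₂ d₃ a a' b b' c c') (h₂ : 0 < d₂) (h₃ : 0 < d₃)
    {p q : ℕ × ℕ} (hp : p ∈ lShape b b' c c') (hq : q ∈ lShape b b' c c') {i : ℤ}
    (e : i * d₁ + p.1 * d₂ + p.2 * d₃ = q.1 * d₂ + q.2 * d₃) : ¬ 0 < i := by
  intro hi
  obtain ⟨j, k⟩ := p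
  obtain ⟨j', k'⟩ := q
  simp only [mem_lShape] at hp hq e
  have hd₂ : (0 : ℤ) < d₂ := by exact_mod_cast h₂
  have hd₃ : (0 : ℤ) < d₃ := by exact_mod_cast h₃
  rcases le_or_gt j' j with hj | hj
  · rcases le_or_gt k' k with hk | hk
    · have hd₁ : (0 : ℤ) ≤ d₁ := Int.natCast_nonneg _
      have : (0 : ℤ) < i * d₁ := by
        refine mul_pos hi (lt_of_le_of_ne hd₁ ?_)
        intro h0
        have := h.rel₁
        rw [show d₁ = 0 by omega] at this
        have : 0 < b' * d₂ := Nat.mul_pos h.b'_pos h₂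
        omega
      nlinarith [mul_nonneg (by omega : (0 : ℤ) ≤ j - j') hd₂.le,
        mul_nonneg (by omega : (0 : ℤ) ≤ k - k') hd₃.le]
    · exact h.min₃.not_rep (i := k' - k) (u := i) (v := j - j') (by omega) (by push_cast; omega)
        (by omega) (by omega) (by linear_combination -e)
  · rcases le_or_gt k' k with hk | hk
    · exact h.min₂.not_rep (i := j' - j) (u := i) (v := k - k') (by omega) (by push_cast; omega)
        (by omega) (by omega) (by linear_combination -e)
    · have hge : ((a + a' : ℕ) : ℤ) ≤ i := by
        by_contra hlt
        exact h.min₁.not_rep (i := i) (u := j' - j) (v := k' - k) hi (by omega)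
          (by omega) (by omega) (by linear_combination e)
      have r₁ : ((a + a' : ℕ) : ℤ) * d₁ = b' * d₂ + c * d₃ := by exact_mod_cast h.rel₁
      have hb' := h.b'_pos
      have hc := h.c_pos
      have e' : (i - (a + a' : ℕ)) * d₁ = (j' - j - b') * d₂ + (k' - k - c) * d₃ := by
        linear_combination e - r₁
      have hnn : 0 ≤ (i - (a + a' : ℕ)) * (d₁ : ℤ) :=
        mul_nonneg (by omega) (Int.natCast_nonneg _)
      rcases le_or_gt 0 ((j' : ℤ) - j - b') with hJ | hJ
      · have hK : (k' : ℤ) - k - c < 0 := by omega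
        have hJ' : 0 < (j' : ℤ) - j - b' := by
          by_contra hle
          have h0 : (j' : ℤ) - j - b' = 0 := by omega
          rw [h0] at e'
          have := mul_neg_of_neg_of_pos hK hd₃
          omega
        exact h.min₂.not_rep (i := j' - j - b') (u := i - (a + a' : ℕ)) (v := -(k' - k - c))
          hJ' (by push_cast; omega) (by omega) (by omega) (by linear_combination -e')
      · have hK : 0 < (k' : ℤ) - k - c := by
          by_contra hle
          have := mul_neg_of_neg_of_pos hJ hd₂
          have := mul_nonpos_of_nonpos_of_nonneg (not_lt.1 hle) hd₃.le
          omega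
        exact h.min₃.not_rep (i := k' - k - c) (u := i - (a + a' : ℕ)) (v := -(j' - j - b'))
          hK (by push_cast; omega) (by omega) (by omega) (by linear_combination -e')

lemma rep_unique (h : Herzog d₁ d₂ d₃ a a' b b' c c') (h₂ : 0 < d₂) (h₃ : 0 < d₃)
    {p q : ℕ × ℕ} (hp : p ∈ lShape b b' c c') (hq : q ∈ lShape b b' c c') {i i' : ℤ}
    (e : i * d₁ + p.1 * d₂ + p.2 * d₃ = i' * d₁ + q.1 * d₂ + q.2 * d₃) : i = i' ∧ p = q := by
  obtain rfl : i = i' := by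
    have l₁ := h.not_lt_of_rep_eq h₂ h₃ hp hq (i := i - i') (by linear_combination e)
    have l₂ := h.not_lt_of_rep_eq h₂ h₃ hq hp (i := i' - i) (by linear_combination -e)
    omega
  refine ⟨rfl, ?_⟩
  obtain ⟨j, k⟩ := p
  obtain ⟨j', k'⟩ := q
  simp only [mem_lShape] at hp hq e
  have hd₂ : (0 : ℤ) < d₂ := by exact_mod_cast h₂
  have hd₃ : (0 : ℤ) < d₃ := by exact_mod_cast h₃
  have hjk : ((j : ℤ) - j') * d₂ = 0 * d₁ + (k' - k) * d₃ := by linear_combination e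
  rcases lt_trichotomy j j' with hj | rfl | hj
  · have hk : 0 ≤ (k : ℤ) - k' := by
      by_contra hlt
      nlinarith [mul_pos (by omega : (0 : ℤ) < j' - j) hd₂,
        mul_pos (by omega : (0 : ℤ) < k' - k) hd₃]
    exact absurd (by linear_combination -hjk) (h.min₂.not_rep (i := j' - j) (u := 0) (v := k - k')
      (by omega) (by push_cast; omega) le_rfl hk)
  · have : ((k' : ℤ) - k) * d₃ = 0 := by linear_combination -hjk
    have := (mul_eq_zero.1 this).resolve_right hd₃.ne'
    rw [show k = k' by omega]
  · have hk : 0 ≤ (k' : ℤ) - k := by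
      by_contra hlt
      nlinarith [mul_pos (by omega : (0 : ℤ) < j - j') hd₂,
        mul_pos (by omega : (0 : ℤ) < k - k') hd₃]
    exact absurd hjk (h.min₂.not_rep (i := j - j') (u := 0) (v := k' - k)
      (by omega) (by push_cast; omega) le_rfl hk)

lemma mem_gen3_iff (h : Herzog d₁ d₂ d₃ a a' b b' c c') (h₁ : 0 < d₁) (h₂ : 0 < d₂) (h₃ : 0 < d₃)
    {p : ℕ × ℕ} (hp : p ∈ lShape b b' c c') {i : ℤ} {n : ℕ}
    (hn : (n : ℤ) = i * d₁ + p.1 * d₂ + p.2 * d₃) : n ∈ gen3 d₁ d₂ d₃ ↔ 0 ≤ i := by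
  constructor
  · intro hmem
    obtain ⟨i', q, hq, e⟩ := h.exists_lShape_rep h₁ hmem
    have e' : (n : ℤ) = i' * d₁ + q.1 * d₂ + q.2 * d₃ := by exact_mod_cast e
    have := (h.rep_unique h₂ h₃ hp hq (hn.symm.trans e')).1
    omega
  · intro hi
    lift i to ℕ using hi
    exact ⟨i, p.1, p.2, by exact_mod_cast hn⟩

lemma exists_int_rep (h : Herzog d₁ d₂ d₃ a a' b b' c c') (h₁ : 0 < d₁)
    (hgcd : Nat.gcd d₁ (Nat.gcd d₂ d₃) = 1) (n : ℤ) :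
    ∃ i : ℤ, ∃ p ∈ lShape b b' c c', n = i * d₁ + p.1 * d₂ + p.2 * d₃ := by
  have b₁ := Nat.gcd_eq_gcd_ab d₁ (Nat.gcd d₂ d₃)
  have b₂ := Nat.gcd_eq_gcd_ab d₂ d₃
  rw [hgcd, b₂] at b₁
  set x := Nat.gcdA d₁ (Nat.gcd d₂ d₃)
  set y := Nat.gcdB d₁ (Nat.gcd d₂ d₃)
  set s := Nat.gcdA d₂ d₃
  set t := Nat.gcdB d₂ d₃
  have hd₁ : (d₁ : ℤ) ≠ 0 := by exact_mod_cast h₁.ne'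
  have u0 := Int.emod_nonneg (n * s * y) hd₁
  have v0 := Int.emod_nonneg (n * t * y) hd₁
  have hu := Int.mul_ediv_add_emod (n * s * y) d₁
  have hv := Int.mul_ediv_add_emod (n * t * y) d₁
  set u := n * s * y % d₁
  set v := n * t * y % d₁
  lift u to ℕ using u0 with u
  lift v to ℕ using v0 with v
  obtain ⟨i, p, hp, e⟩ := h.exists_lShape_rep h₁ (n := u * d₂ + v * d₃) ⟨0, u, v, by ring⟩
  zify at e
  refine ⟨i + (n * x + n * s * y / d₁ * d₂ + n * t * y / d₁ * d₃), p, hp, ?_⟩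
  push_cast at b₁
  linear_combination n * b₁ - d₂ * hu - d₃ * hv + e


lemma sum_mod_lShape {M : Type*} [AddCommMonoid M] (h : Herzog d₁ d₂ d₃ a a' b b' c c')
    (h₁ : 0 < d₁) (h₂ : 0 < d₂) (h₃ : 0 < d₃) (hgcd : Nat.gcd d₁ (Nat.gcd d₂ d₃) = 1)
    (f : ℕ → M) :
    ∑ p ∈ lShape b b' c c', f ((p.1 * d₂ + p.2 * d₃) % d₁) = ∑ r ∈ Finset.range d₁, f r := by
  refine Finset.sum_nbij (fun p => (p.1 * d₂ + p.2 * d₃) % d₁) ?_ ?_ ?_ fun _ _ => rfl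
  · intro p _
    exact Finset.mem_range.2 (Nat.mod_lt _ h₁)
  · intro p hp q hq e
    have ep := Nat.div_add_mod (p.1 * d₂ + p.2 * d₃) d₁
    have eq := Nat.div_add_mod (q.1 * d₂ + q.2 * d₃) d₁
    dsimp only at e
    rw [e] at ep
    generalize (p.1 * d₂ + p.2 * d₃) / d₁ = m at ep
    generalize (q.1 * d₂ + q.2 * d₃) / d₁ = m' at eq
    zify at ep eq
    exact (h.rep_unique h₂ h₃ hp hq (i := m') (i' := m) (by linear_combination eq - ep)).2
  · intro r hr
    obtain ⟨i, p, hp, e⟩ := h.exists_int_rep h₁ hgcd r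
    refine ⟨p, hp, ?_⟩
    have hr' := Finset.mem_range.1 hr
    dsimp only
    zify
    rw [show (p.1 * d₂ + p.2 * d₃ : ℤ) = r + d₁ * (-i) by linear_combination -e,
      Int.add_mul_emod_self_left]
    exact Int.emod_eq_of_lt (by omega) (by omega)

/-- The gaps are obtained by descending from the Apéry set in steps of `d₁`. -/
lemma compl_gen3 (h : Herzog d₁ d₂ d₃ a a' b b' c c') (h₁ : 0 < d₁) (h₂ : 0 < d₂) (h₃ : 0 < d₃)
    (hgcd : Nat.gcd d₁ (Nat.gcd d₂ d₃) = 1) :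
    ∃ G : Finset ℕ, (gen3 d₁ d₂ d₃)ᶜ = ↑G ∧ ∀ f : ℕ → ℝ, ∑ s ∈ G, f s =
      ∑ p ∈ lShape b b' c c', ∑ i ∈ Finset.range ((p.1 * d₂ + p.2 * d₃) / d₁),
        f (p.1 * d₂ + p.2 * d₃ - (i + 1) * d₁) := by
  classical
  have hle : ∀ (p : ℕ × ℕ) (i : ℕ), i < (p.1 * d₂ + p.2 * d₃) / d₁ →
      (i + 1) * d₁ ≤ p.1 * d₂ + p.2 * d₃ := fun p i hi =>
    (Nat.mul_le_mul_right d₁ hi).trans (Nat.div_mul_le_self _ _)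
  have hcast : ∀ (p : ℕ × ℕ) (i : ℕ), i < (p.1 * d₂ + p.2 * d₃) / d₁ →
      ((p.1 * d₂ + p.2 * d₃ - (i + 1) * d₁ : ℕ) : ℤ) =
        (-1 - i : ℤ) * d₁ + p.1 * d₂ + p.2 * d₃ := fun p i hi => by
    rw [Nat.cast_sub (hle p i hi)]
    push_cast
    ring
  refine ⟨((lShape b b' c c').sigma fun p => Finset.range ((p.1 * d₂ + p.2 * d₃) / d₁)).image
    fun x => x.1.1 * d₂ + x.1.2 * d₃ - (x.2 + 1) * d₁, ?_, fun f => ?_⟩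
  · ext n
    simp only [Set.mem_compl_iff, Finset.coe_image, Set.mem_image, Finset.mem_coe,
      Finset.mem_sigma, Finset.mem_range]
    constructor
    · intro hn
      obtain ⟨i, p, hp, e⟩ := h.exists_int_rep h₁ hgcd n
      rw [h.mem_gen3_iff h₁ h₂ h₃ hp e] at hn
      obtain ⟨m, rfl⟩ : ∃ m : ℕ, i = -1 - m := ⟨(-1 - i).toNat, by omega⟩
      have e' : n + (m + 1) * d₁ = p.1 * d₂ + p.2 * d₃ := by
        zify
        linear_combination e
      refine ⟨⟨p, m⟩, ⟨hp, ?_⟩, ?_⟩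
      · exact (Nat.le_div_iff_mul_le h₁).2 (by dsimp only; rw [Nat.succ_eq_add_one]; omega)
      · dsimp only
        omega
    · rintro ⟨⟨p, i⟩, ⟨hp, hi⟩, rfl⟩
      rw [h.mem_gen3_iff h₁ h₂ h₃ hp (hcast p i hi)]
      omega
  · rw [Finset.sum_image, Finset.sum_sigma]
    rintro ⟨p, i⟩ hp ⟨q, j⟩ hq e
    simp only [Finset.coe_sigma, Set.mem_sigma_iff, Finset.mem_coe, Finset.mem_range] at hp hq
    dsimp only at e
    have e' : (-1 - i : ℤ) * d₁ + p.1 * d₂ + p.2 * d₃ = (-1 - j) * d₁ + q.1 * d₂ + q.2 * d₃ := by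
      rw [← hcast p i hp.2, ← hcast q j hq.2, e]
    obtain ⟨hij, rfl⟩ := h.rep_unique h₂ h₃ hp.1 hq.1 e'
    rw [show i = j by omega]

lemma frobeniusNum_add (h : Herzog d₁ d₂ d₃ a a' b b' c c') (h₁ : 0 < d₁) (h₂ : 0 < d₂)
    (h₃ : 0 < d₃) (hgcd : Nat.gcd d₁ (Nat.gcd d₂ d₃) = 1) (ht : c' * d₃ ≤ b * d₂)
    (hne : (gen3 d₁ d₂ d₃)ᶜ.Nonempty) :
    frobeniusNum (gen3 d₁ d₂ d₃) + (d₁ + d₂ + d₃) = (b + b') * d₂ + c * d₃ := by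
  have hd₂ : (0 : ℤ) < d₂ := by exact_mod_cast h₂
  have hd₃ : (0 : ℤ) < d₃ := by exact_mod_cast h₃
  have ht' : (c' : ℤ) * d₃ ≤ b * d₂ := by exact_mod_cast ht
  have hle : ∀ n ∈ (gen3 d₁ d₂ d₃)ᶜ, n + (d₁ + d₂ + d₃) ≤ (b + b') * d₂ + c * d₃ := by
    intro n hn
    obtain ⟨i, p, hp, e⟩ := h.exists_int_rep h₁ hgcd n
    rw [Set.mem_compl_iff, h.mem_gen3_iff h₁ h₂ h₃ hp e] at hn
    have hi : (i + 1) * (d₁ : ℤ) ≤ 0 :=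
      mul_nonpos_of_nonpos_of_nonneg (by omega) (Int.natCast_nonneg _)
    rw [mem_lShape] at hp
    zify
    rcases lt_or_ge p.2 c with hk | hk
    · nlinarith [mul_le_mul_of_nonneg_right (by omega : (p.1 : ℤ) + 1 ≤ b + b') hd₂.le,
        mul_le_mul_of_nonneg_right (by omega : (p.2 : ℤ) + 1 ≤ c) hd₃.le]
    · nlinarith [mul_le_mul_of_nonneg_right (by omega : (p.1 : ℤ) + 1 ≤ b') hd₂.le,
        mul_le_mul_of_nonneg_right (by omega : (p.2 : ℤ) + 1 ≤ c + c') hd₃.le]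
  have hb := h.b_pos
  have hc := h.c_pos
  obtain ⟨n₀, hn₀⟩ := hne
  have hn₀' := hle n₀ hn₀
  obtain ⟨N, hN⟩ : ∃ N, N + (d₁ + d₂ + d₃) = (b + b') * d₂ + c * d₃ :=
    ⟨(b + b') * d₂ + c * d₃ - (d₁ + d₂ + d₃), by omega⟩
  have hgap : N ∈ (gen3 d₁ d₂ d₃)ᶜ := by
    have hp : (b + b' - 1, c - 1) ∈ lShape b b' c c' :=
      mem_lShape.2 ⟨by dsimp only; omega, by dsimp only; omega, Or.inr (by dsimp only; omega)⟩
    have e : (N : ℤ) = (-1 : ℤ) * d₁ + (b + b' - 1 : ℕ) * d₂ + (c - 1 : ℕ) * d₃ := by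
      rw [Nat.cast_sub (by omega), Nat.cast_sub (by omega)]
      zify at hN
      push_cast
      linear_combination hN
    rw [Set.mem_compl_iff, h.mem_gen3_iff h₁ h₂ h₃ hp e]
    omega
  have hgreatest : IsGreatest (gen3 d₁ d₂ d₃)ᶜ N := ⟨hgap, fun n hn => by
    have := hle n hn
    omega⟩
  rw [frobeniusNum, hgreatest.csSup_eq, hN]

end Herzog

lemma sum_range_cast (n : ℕ) : ∑ i ∈ Finset.range n, (i : ℝ) = n * (n - 1) / 2 := by
  induction n with
  | zero => simp
  | succ n ih => rw [Finset.sum_range_succ, ih]; push_cast; ring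

lemma sum_range_cast_sq (n : ℕ) :
    ∑ i ∈ Finset.range n, (i : ℝ) ^ 2 = n * (n - 1) * (2 * n - 1) / 6 := by
  induction n with
  | zero => simp
  | succ n ih => rw [Finset.sum_range_succ, ih]; push_cast; ring

lemma sum_linear_rect (m n : ℕ) (x y : ℝ) :
    ∑ j ∈ Finset.range m, ∑ k ∈ Finset.range n, (j * x + k * y) =
      x * n * (m * (m - 1) / 2) + y * m * (n * (n - 1) / 2) := by
  simp only [Finset.sum_add_distrib, ← Finset.sum_mul, sum_range_cast, Finset.sum_const,
    Finset.card_range, nsmul_eq_mul, ← Finset.mul_sum]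
  ring

lemma sum_quadratic_rect (m n : ℕ) (x y : ℝ) :
    ∑ j ∈ Finset.range m, ∑ k ∈ Finset.range n, (j * x + k * y) ^ 2 =
      x ^ 2 * n * (m * (m - 1) * (2 * m - 1) / 6) +
        2 * x * y * (m * (m - 1) / 2) * (n * (n - 1) / 2) +
        y ^ 2 * m * (n * (n - 1) * (2 * n - 1) / 6) := by
  have hexp : ∀ j k : ℕ, ((j : ℝ) * x + k * y) ^ 2 =
      x ^ 2 * (j : ℝ) ^ 2 + 2 * x * y * j * k + y ^ 2 * (k : ℝ) ^ 2 := fun j k => by ring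
  simp only [hexp, Finset.sum_add_distrib, ← Finset.sum_mul, sum_range_cast, sum_range_cast_sq,
    Finset.sum_const, Finset.card_range, nsmul_eq_mul, ← Finset.mul_sum]
  ring

/-- Sum of the members of an arithmetic progression descending from `w` in steps of `d`. -/
lemma sum_descending (w d : ℕ) :
    2 * (d : ℝ) * ∑ i ∈ Finset.range (w / d), ((w - (i + 1) * d : ℕ) : ℝ) =
      (w : ℝ) ^ 2 - ((w % d : ℕ) : ℝ) ^ 2 - d * (w - ((w % d : ℕ) : ℝ)) := by
  have hsum : ∑ i ∈ Finset.range (w / d), ((w - (i + 1) * d : ℕ) : ℝ) =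
      ∑ i ∈ Finset.range (w / d), ((w : ℝ) - d - i * d) := by
    refine Finset.sum_congr rfl fun i hi => ?_
    have hle : (i + 1) * d ≤ w :=
      (Nat.mul_le_mul_right d (Finset.mem_range.1 hi)).trans (Nat.div_mul_le_self _ _)
    rw [Nat.cast_sub hle]
    push_cast
    ring
  have hw : (w : ℝ) = d * (w / d : ℕ) + (w % d : ℕ) := by
    exact_mod_cast (Nat.div_add_mod w d).symm
  rw [hsum, Finset.sum_sub_distrib, ← Finset.sum_mul, sum_range_cast, Finset.sum_const,
    Finset.card_range, nsmul_eq_mul]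
  linear_combination (d - ((w % d : ℕ) + w - d * (w / d : ℕ)) : ℝ) * hw

namespace Herzog

variable {d₁ d₂ d₃ a a' b b' c c' : ℕ}

lemma d₁_eq (h : Herzog d₁ d₂ d₃ a a' b b' c c') (h₁ : 0 < d₁) (h₂ : 0 < d₂)
    (h₃ : 0 < d₃) (hgcd : Nat.gcd d₁ (Nat.gcd d₂ d₃) = 1) :
    (d₁ : ℝ) = b * c + b' * c + b' * c' := by
  have key := h.sum_mod_lShape h₁ h₂ h₃ hgcd (fun _ => (1 : ℝ))
  rw [sum_lShape b b' c c' (fun _ _ => (1 : ℝ))] at key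
  simp only [Finset.sum_const, Finset.card_range, nsmul_eq_mul, mul_one] at key
  push_cast at key
  linear_combination -key

lemma genus_eq (h : Herzog d₁ d₂ d₃ a a' b b' c c') (h₁ : 0 < d₁) (h₂ : 0 < d₂)
    (h₃ : 0 < d₃) (hgcd : Nat.gcd d₁ (Nat.gcd d₂ d₃) = 1) :
    (d₁ : ℝ) * genus (gen3 d₁ d₂ d₃) =
      ∑ p ∈ lShape b b' c c', ((p.1 : ℝ) * d₂ + p.2 * d₃) - d₁ * (d₁ - 1) / 2 := by
  obtain ⟨G, hG, hsum⟩ := h.compl_gen3 h₁ h₂ h₃ hgcd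
  have hcard := hsum fun _ => 1
  simp only [Finset.sum_const, Finset.card_range, nsmul_eq_mul, mul_one] at hcard
  rw [genus, hG, Set.ncard_coe_finset, hcard, ← sum_range_cast,
    ← h.sum_mod_lShape h₁ h₂ h₃ hgcd (fun r => (r : ℝ)), Finset.mul_sum, ← Finset.sum_sub_distrib]
  refine Finset.sum_congr rfl fun p _ => ?_
  have : ((p.1 * d₂ + p.2 * d₃ : ℕ) : ℝ) =
      d₁ * ((p.1 * d₂ + p.2 * d₃) / d₁ : ℕ) + ((p.1 * d₂ + p.2 * d₃) % d₁ : ℕ) := by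
    exact_mod_cast (Nat.div_add_mod _ d₁).symm
  push_cast at this ⊢
  linarith

lemma gapPowerSum_one_eq (h : Herzog d₁ d₂ d₃ a a' b b' c c') (h₁ : 0 < d₁) (h₂ : 0 < d₂)
    (h₃ : 0 < d₃) (hgcd : Nat.gcd d₁ (Nat.gcd d₂ d₃) = 1) :
    2 * (d₁ : ℝ) * gapPowerSum (gen3 d₁ d₂ d₃) 1 =
      ∑ p ∈ lShape b b' c c', ((p.1 : ℝ) * d₂ + p.2 * d₃) ^ 2 -
        d₁ * (d₁ - 1) * (2 * d₁ - 1) / 6 -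
        d₁ * (∑ p ∈ lShape b b' c c', ((p.1 : ℝ) * d₂ + p.2 * d₃) - d₁ * (d₁ - 1) / 2) := by
  obtain ⟨G, hG, hsum⟩ := h.compl_gen3 h₁ h₂ h₃ hgcd
  have hgap : (gapPowerSum (gen3 d₁ d₂ d₃) 1 : ℝ) = ∑ s ∈ G, (s : ℝ) := by
    rw [gapPowerSum, hG, finsum_mem_coe_finset]
    push_cast
    exact Finset.sum_congr rfl fun s _ => pow_one _
  rw [hgap, hsum fun s => (s : ℝ), ← sum_range_cast, ← sum_range_cast_sq,
    ← h.sum_mod_lShape h₁ h₂ h₃ hgcd (fun r => (r : ℝ)),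
    ← h.sum_mod_lShape h₁ h₂ h₃ hgcd (fun r => (r : ℝ) ^ 2), ← Finset.sum_sub_distrib,
    ← Finset.sum_sub_distrib, Finset.mul_sum, Finset.mul_sum, ← Finset.sum_sub_distrib]
  refine Finset.sum_congr rfl fun p _ => ?_
  have := sum_descending (p.1 * d₂ + p.2 * d₃) d₁
  push_cast at this ⊢
  linarith

end Herzog

/-- The bounds, for the closed form of `K₁` in terms of `x = a' d₁`, `y = b' d₂`, `z = c' d₃` and
the distance `t` of the two syzygy degrees. -/
lemma closed_form_bounds {x y z t : ℝ} (hx : 0 < x) (hy : 0 < y) (hz : 0 < z) (ht : 0 ≤ t) :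
    5 / 36 * (x + y + z + 2 * t) ^ 2 <
      (2 * (x + y + z) ^ 2 + 7 * (x + y + z) * t + 7 * t ^ 2 - (x * y + y * z + z * x)) / 12 +
        (2 * (x + y + z) + 3 * t) * (x * y * z) /
          (6 * (t ^ 2 + t * (x + y + z) + (x * y + y * z + z * x))) ∧
    (2 * (x + y + z) ^ 2 + 7 * (x + y + z) * t + 7 * t ^ 2 - (x * y + y * z + z * x)) / 12 +
        (2 * (x + y + z) + 3 * t) * (x * y * z) /
          (6 * (t ^ 2 + t * (x + y + z) + (x * y + y * z + z * x))) <
      11 / 54 * (x + y + z + 2 * t) ^ 2 := by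
  have hxy := mul_pos hx hy
  have hyz := mul_pos hy hz
  have hzx := mul_pos hz hx
  have hs : 0 < x + y + z := by positivity
  have hst : 0 ≤ (x + y + z) * t := by positivity
  have hpi : 0 < t ^ 2 + t * (x + y + z) + (x * y + y * z + z * x) := by positivity
  constructor
  · have hpos : 0 < (2 * (x + y + z) + 3 * t) * (x * y * z) /
        (6 * (t ^ 2 + t * (x + y + z) + (x * y + y * z + z * x))) := by positivity
    nlinarith [sq_nonneg (x - y), sq_nonneg (y - z), sq_nonneg (z - x), sq_nonneg t]
  · have hamgm : x * y * z ≤ (x + y + z) / 9 *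
        (t ^ 2 + t * (x + y + z) + (x * y + y * z + z * x)) := by
      have h9 : 9 * (x * y * z) ≤ (x + y + z) * (x * y + y * z + z * x) := by
        nlinarith [mul_nonneg hx.le (sq_nonneg (y - z)), mul_nonneg hy.le (sq_nonneg (z - x)),
          mul_nonneg hz.le (sq_nonneg (x - y))]
      have h0 : 0 ≤ (x + y + z) * (t ^ 2 + t * (x + y + z)) := by positivity
      nlinarith
    have hle : (2 * (x + y + z) + 3 * t) * (x * y * z) /
        (6 * (t ^ 2 + t * (x + y + z) + (x * y + y * z + z * x))) ≤
        (2 * (x + y + z) + 3 * t) * ((x + y + z) / 54) := by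
      rw [div_le_iff₀ (by positivity)]
      have := mul_le_mul_of_nonneg_left hamgm (by positivity : 0 ≤ 2 * (x + y + z) + 3 * t)
      linarith
    nlinarith [sq_nonneg t]

lemma Herzog.K₁_bounds {d₁ d₂ d₃ a a' b b' c c' : ℕ} (h : Herzog d₁ d₂ d₃ a a' b b' c c')
    (h₁ : 0 < d₁) (h₂ : 0 < d₂) (h₃ : 0 < d₃) (hgcd : Nat.gcd d₁ (Nat.gcd d₂ d₃) = 1)
    (ht : c' * d₃ ≤ b * d₂) (hne : (gen3 d₁ d₂ d₃)ᶜ.Nonempty) {σ K g : ℝ}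
    (hσ : σ = (d₁ : ℝ) + d₂ + d₃) (hg : g = (frobeniusNum (gen3 d₁ d₂ d₃) : ℝ) + σ)
    (hK : K = (gapPowerSum (gen3 d₁ d₂ d₃) 1 : ℝ) + σ / 2 * (genus (gen3 d₁ d₂ d₃) : ℝ) +
      (3 * ((σ - 1) / 2) ^ 2 + ((d₁ : ℝ) ^ 2 + (d₂ : ℝ) ^ 2 + (d₃ : ℝ) ^ 2 - 1) / 4) / 6) :
    0 < g ∧ 5 / 36 * g ^ 2 < K ∧ K < 11 / 54 * g ^ 2 := by
  have H₁ : (0 : ℝ) < d₁ := by exact_mod_cast h₁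
  have H₂ : (0 : ℝ) < d₂ := by exact_mod_cast h₂
  have H₃ : (0 : ℝ) < d₃ := by exact_mod_cast h₃
  have hx : (0 : ℝ) < c * d₃ - (b * d₂ - c' * d₃) := by
    have e₃ : ((c : ℝ) + c') * d₃ = a' * d₁ + b * d₂ := by exact_mod_cast h.rel₃
    have : (0 : ℝ) < a' * d₁ := mul_pos (by exact_mod_cast h.a'_pos) H₁
    linarith
  have hy : (0 : ℝ) < b' * d₂ := mul_pos (by exact_mod_cast h.b'_pos) H₂
  have hz : (0 : ℝ) < c' * d₃ := mul_pos (by exact_mod_cast h.c'_pos) H₃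
  have ht' : (0 : ℝ) ≤ b * d₂ - c' * d₃ := by
    have : (c' : ℝ) * d₃ ≤ b * d₂ := by exact_mod_cast ht
    linarith
  have hgw : g = (c * d₃ - (b * d₂ - c' * d₃)) + b' * d₂ + c' * d₃ + 2 * (b * d₂ - c' * d₃) := by
    have : (frobeniusNum (gen3 d₁ d₂ d₃) : ℝ) + (d₁ + d₂ + d₃) = (b + b') * d₂ + c * d₃ := by
      exact_mod_cast h.frobeniusNum_add h₁ h₂ h₃ hgcd ht hne
    rw [hg, hσ, this]
    ring
  have hd := h.d₁_eq h₁ h₂ h₃ hgcd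
  have hG₀ := h.genus_eq h₁ h₂ h₃ hgcd
  have hG₁ := h.gapPowerSum_one_eq h₁ h₂ h₃ hgcd
  rw [sum_lShape b b' c c' fun j k => ((j : ℝ) * d₂ + k * d₃), sum_linear_rect, sum_linear_rect,
    sum_linear_rect] at hG₀ hG₁
  rw [sum_lShape b b' c c' fun j k => ((j : ℝ) * d₂ + k * d₃) ^ 2, sum_quadratic_rect,
    sum_quadratic_rect, sum_quadratic_rect] at hG₁
  push_cast at hG₀ hG₁
  set G₀ : ℝ := (genus (gen3 d₁ d₂ d₃) : ℝ)
  set G₁ : ℝ := (gapPowerSum (gen3 d₁ d₂ d₃) 1 : ℝ)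
  obtain ⟨hlow, hupp⟩ := closed_form_bounds hx hy hz ht'
  refine ⟨by rw [hgw]; linarith, ?_⟩
  rw [hgw]
  suffices e : _ = K from ⟨hlow.trans_eq e, e.symm.trans_lt hupp⟩
  have hpi : (b * d₂ - c' * d₃ : ℝ) ^ 2 + (b * d₂ - c' * d₃) *
      ((c * d₃ - (b * d₂ - c' * d₃)) + b' * d₂ + c' * d₃) +
      ((c * d₃ - (b * d₂ - c' * d₃)) * (b' * d₂) + b' * d₂ * (c' * d₃) +
        c' * d₃ * (c * d₃ - (b * d₂ - c' * d₃))) = d₁ * d₂ * d₃ := by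
    rw [hd]
    ring
  rw [hpi]
  have hG₀' := eq_div_of_mul_eq H₁.ne' ((mul_comm _ _).trans hG₀)
  have hG₁' := eq_div_of_mul_eq (by positivity : 2 * (d₁ : ℝ) ≠ 0) ((mul_comm _ _).trans hG₁)
  rw [hK, hG₀', hG₁', hσ]
  field_simp
  rw [hd]
  ring

lemma gen3_swap_right (x y z : ℕ) : gen3 x y z = gen3 x z y := by
  ext n
  rw [← intGen_natCast, ← intGen_natCast, intGen_swap_right]

/-- For a non-symmetric `S₃ = ⟨d₁,d₂,d₃⟩` minimally generated by three positive
integers, the rescaled genus `h₁ = K₁/g₃²` satisfies `5/36 < h₁ < 11/54`. -/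
theorem h1_bounds_nonsymmetric (d₁ d₂ d₃ : ℕ) (h : MinGen3 d₁ d₂ d₃)
    (hns : ¬ IsSymmetric (gen3 d₁ d₂ d₃))
    (σ₁ σ₂ δ₁ δ₂ g₃ K₁ h₁ : ℝ)
    (hσ₁ : σ₁ = (d₁ : ℝ) + d₂ + d₃)
    (hσ₂ : σ₂ = (d₁ : ℝ) ^ 2 + (d₂ : ℝ) ^ 2 + (d₃ : ℝ) ^ 2)
    (hδ₁ : δ₁ = (σ₁ - 1) / 2) (hδ₂ : δ₂ = (σ₂ - 1) / 4)
    (hg₃ : g₃ = (frobeniusNum (gen3 d₁ d₂ d₃) : ℝ) + σ₁)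
    (hK₁ : K₁ = (gapPowerSum (gen3 d₁ d₂ d₃) 1 : ℝ) +
        σ₁ / 2 * (genus (gen3 d₁ d₂ d₃) : ℝ) + (3 * δ₁ ^ 2 + δ₂) / 6)
    (hh₁ : h₁ = K₁ / g₃ ^ 2) :
    5 / 36 < h₁ ∧ h₁ < 11 / 54 := by
  obtain ⟨hd₁, h12, h23, -, hgcd, -, -, -⟩ := h
  have hne : (gen3 d₁ d₂ d₃)ᶜ.Nonempty := by
    refine ⟨1, ?_⟩
    rintro ⟨i, j, k, e⟩
    have hi : i = 0 := by nlinarith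
    have hj : j = 0 := by nlinarith
    have hk : k = 0 := by nlinarith
    simp [hi, hj, hk] at e
  have h₁ : 0 < d₁ := by omega
  have h₂ : 0 < d₂ := by omega
  have h₃ : 0 < d₃ := by omega
  obtain ⟨a, a', b, b', c, c', h⟩ :=
    exists_herzog h₁ h₂ h₃ hgcd fun hs => hns hs.isSymmetric
  rw [hδ₁, hδ₂, hσ₂] at hK₁
  have key : 0 < g₃ ∧ 5 / 36 * g₃ ^ 2 < K₁ ∧ K₁ < 11 / 54 * g₃ ^ 2 := by
    rcases le_total (c' * d₃) (b * d₂) with ht | ht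
    · exact h.K₁_bounds h₁ h₂ h₃ hgcd ht hne hσ₁ hg₃ hK₁
    · rw [gen3_swap_right] at hne hg₃ hK₁
      exact h.swap.K₁_bounds h₁ h₃ h₂ (by rwa [Nat.gcd_comm d₃]) ht hne
        (by rw [hσ₁]; ring) hg₃ (by rw [hK₁]; ring)
  obtain ⟨hg, hlow, hupp⟩ := key
  have hg2 : 0 < g₃ ^ 2 := by positivity
  rw [hh₁, lt_div_iff₀ hg2, div_lt_iff₀ hg2]
  exact ⟨hlow, hupp⟩
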